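/- The symmetric bilinear form h on W is nondegenerate if and only if Φ⁺ := π⁺ ∘ Φ is a linear isomorphism of W onto E⁺ and Φ⁻ := π⁻ ∘ Φ is a linear isomorphism of W onto E⁻. (Paper's Lemma 3.10, pointwise linear-algebraic form.) -/

import Mathlib

/-- Paper's Lemma 3.10 (pointwise linear-algebraic form): with a para-Hermitian
structure `(τ, I)` on `V`, `dim V = 2 dim W`, and an injective linear map
`Φ : W → V` with Lagrangian image, the pullback form `h y z = τ (Φ y) (Φ z)` is
nondegenerate iff `Φ⁺ = π⁺ ∘ Φ` (i.e. `y ↦ (1/2)(Φ y + I (Φ y))`) is a linear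
isomorphism of `W` onto `E⁺ = ker (I - id)` and `Φ⁻ = π⁻ ∘ Φ`
(i.e. `y ↦ (1/2)(Φ y - I (Φ y))`) is a linear isomorphism of `W` onto
`E⁻ = ker (I + id)`. -/
theorem statement7 (V W : Type*)
    [AddCommGroup V] [Module ℝ V] [FiniteDimensional ℝ V]
    [AddCommGroup W] [Module ℝ W] [FiniteDimensional ℝ W]
    (hdim : Module.finrank ℝ V = 2 * Module.finrank ℝ W)
    (τ : V →ₗ[ℝ] V →ₗ[ℝ] ℝ)
    (hτsymm : ∀ x y : V, τ x y = τ y x)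
    (hτnd : ∀ x : V, (∀ y : V, τ x y = 0) → x = 0)
    (I : V →ₗ[ℝ] V)
    (hI : I ∘ₗ I = LinearMap.id)
    (hIne : I ≠ LinearMap.id)
    (hcompat : ∀ x y : V, τ (I x) y + τ x (I y) = 0)
    (Φ : W →ₗ[ℝ] V) (hΦinj : Function.Injective Φ)
    (hLag : ∀ y z : W, τ (Φ y) (I (Φ z)) = 0) :
    -- h is nondegenerate
    (∀ y : W, (∀ z : W, τ (Φ y) (Φ z) = 0) → y = 0)
    ↔
    -- Φ⁺ is an isomorphism of W onto E⁺ and Φ⁻ is an isomorphism of W onto E⁻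
    ((Function.Injective ⇑(((1:ℝ)/2) • (Φ + I ∘ₗ Φ)) ∧
        LinearMap.range (((1:ℝ)/2) • (Φ + I ∘ₗ Φ)) = LinearMap.ker (I - LinearMap.id)) ∧
      (Function.Injective ⇑(((1:ℝ)/2) • (Φ - I ∘ₗ Φ)) ∧
        LinearMap.range (((1:ℝ)/2) • (Φ - I ∘ₗ Φ)) = LinearMap.ker (I + LinearMap.id))) := by
  have hII : ∀ x, I (I x) = x := fun x => LinearMap.congr_fun hI x
  constructor
  · intro hnd
    have hinj₁ : Function.Injective ⇑(((1:ℝ)/2) • (Φ + I ∘ₗ Φ)) := by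
      rw [injective_iff_map_eq_zero]
      intro y hy
      have h : Φ y + I (Φ y) = 0 := by simpa [← smul_add] using hy
      refine hnd y fun z => ?_
      rw [hτsymm, eq_neg_of_add_eq_zero_left h, map_neg, hLag, neg_zero]
    have hinj₂ : Function.Injective ⇑(((1:ℝ)/2) • (Φ - I ∘ₗ Φ)) := by
      rw [injective_iff_map_eq_zero]
      intro y hy
      have h : Φ y - I (Φ y) = 0 := by simpa using hy
      refine hnd y fun z => ?_
      rw [hτsymm, sub_eq_zero.mp h, hLag]
    have hle₁ : LinearMap.range (((1:ℝ)/2) • (Φ + I ∘ₗ Φ)) ≤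
        LinearMap.ker (I - LinearMap.id) := by
      rintro _ ⟨y, rfl⟩
      simp [hII, add_comm]
    have hle₂ : LinearMap.range (((1:ℝ)/2) • (Φ - I ∘ₗ Φ)) ≤
        LinearMap.ker (I + LinearMap.id) := by
      rintro _ ⟨y, rfl⟩
      simp [hII]
    have hdisj : LinearMap.ker (I - LinearMap.id) ⊓ LinearMap.ker (I + LinearMap.id) = ⊥ := by
      rw [eq_bot_iff]
      rintro x ⟨h₁, h₂⟩
      have h₁ : I x = x := by simpa [sub_eq_zero] using h₁
      have h₂ : I x + x = 0 := by simpa using h₂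
      rw [h₁, ← two_smul ℝ x, smul_eq_zero_iff_right two_ne_zero] at h₂
      exact h₂
    have hsum := Submodule.finrank_sup_add_finrank_inf_eq
      (LinearMap.ker (I - LinearMap.id)) (LinearMap.ker (I + LinearMap.id))
    rw [hdisj, finrank_bot] at hsum
    have hsup := Submodule.finrank_le
      (LinearMap.ker (I - LinearMap.id) ⊔ LinearMap.ker (I + LinearMap.id))
    have hrank₁ := LinearMap.finrank_range_of_inj hinj₁
    have hrank₂ := LinearMap.finrank_range_of_inj hinj₂
    have hmono₁ := Submodule.finrank_mono hle₁
    have hmono₂ := Submodule.finrank_mono hle₂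
    exact ⟨⟨hinj₁, Submodule.eq_of_le_of_finrank_le hle₁ (by omega)⟩,
      ⟨hinj₂, Submodule.eq_of_le_of_finrank_le hle₂ (by omega)⟩⟩
  · rintro ⟨⟨-, hr₁⟩, ⟨-, hr₂⟩⟩ y hy
    apply hΦinj
    rw [map_zero]
    refine hτnd _ fun v => ?_
    have h₁ : v + I v ∈ LinearMap.ker (I - LinearMap.id) := by simp [hII, add_comm]
    have h₂ : v - I v ∈ LinearMap.ker (I + LinearMap.id) := by simp [hII]
    rw [← hr₁] at h₁
    rw [← hr₂] at h₂
    obtain ⟨a, ha⟩ := h₁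
    obtain ⟨b, hb⟩ := h₂
    have ha' : τ (Φ y) (v + I v) = 0 := by simp [← ha, hy, hLag]
    have hb' : τ (Φ y) (v - I v) = 0 := by simp [← hb, hy, hLag]
    rw [map_add] at ha'
    rw [map_sub] at hb'
    linarith
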